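/- Let a ∈ ℝ ∪ {−∞} and let φ : (a,∞) → ℝ be smooth with φ'(t) > 0 and φ''(t) ≥ 0 for all t. Fix u₀ ∈ (a,∞) and let u : [0, ω₊) → (a,∞) (0 < ω₊ ≤ ∞) be the maximal C² solution of the rotational [φ,e₃]-minimal equation u''(r) = (1 + u'(r)²)·(φ'(u(r)) − u'(r)/r) (r > 0) with u(0) = u₀, u'(0) = 0. Then u''(r) > 0 for all r ∈ [0, ω₊) (with u''(0) = φ'(u₀)/2), u'(r) > 0 and u'(r) < r·φ'(u(r)) for all r ∈ (0, ω₊), and lim_{r→ω₊} u(r) = +∞. In particular u is a strictly convex function with minimum at r = 0 whose rotation graph is a [φ,e₃]-minimal bowl. -/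

import Mathlib

open Set Filter
open scoped ENNReal Topology

/-- The interval `[0, ω)` (all of `[0,∞)` when `ω = ∞`). -/
def Dom (ω : ℝ≥0∞) : Set ℝ := {r : ℝ | 0 ≤ r ∧ ENNReal.ofReal r < ω}

/-- The filter of `r → ω⁻` (i.e. `r → +∞` when `ω = ∞`). -/
noncomputable def rightEnd (ω : ℝ≥0∞) : Filter ℝ :=
  if ω = ⊤ then Filter.atTop else nhdsWithin ω.toReal (Set.Iio ω.toReal)

lemma glue_deriv (f f1 g : ℝ → ℝ) (W e : ℝ) (hW : 0 < W)
    (hf : ∀ t ∈ Ioo 0 W, HasDerivAt f (f1 t) t)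
    (hl : Tendsto f (𝓝[<] W) (𝓝 (g W)))
    (hl1 : Tendsto f1 (𝓝[<] W) (𝓝 e))
    (hg : HasDerivAt g e W) :
    HasDerivAt (fun t => if t < W then f t else g t) e W := by
  set h : ℝ → ℝ := fun t => if t < W then f t else g t with hh
  have hhW : h W = g W := by simp [hh]
  have hmem : Ioo 0 W ∈ 𝓝[<] W := Ioo_mem_nhdsLT hW
  have hder : ∀ t ∈ Ioo 0 W, HasDerivAt h (f1 t) t := by
    intro t ht
    apply (hf t ht).congr_of_eventuallyEq
    filter_upwards [Iio_mem_nhds ht.2] with s hs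
    simp only [hh]; rw [if_pos (mem_Iio.mp hs)]
  have h1 : HasDerivWithinAt h e (Iic W) W := by
    apply hasDerivWithinAt_Iic_of_tendsto_deriv (s := Ioo 0 W)
    · intro t ht
      exact (hder t ht).differentiableAt.differentiableWithinAt
    · unfold ContinuousWithinAt
      rw [hhW]
      have : Tendsto h (𝓝[<] W) (𝓝 (g W)) := by
        apply hl.congr'
        filter_upwards [self_mem_nhdsWithin] with s hs
        simp only [hh]; rw [if_pos (mem_Iio.mp hs)]
      exact this.mono_left (nhdsWithin_mono _ (fun x hx => hx.2))
    · exact hmem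
    · apply hl1.congr'
      filter_upwards [hmem] with s hs
      exact (hder s hs).deriv.symm
  have h2 : HasDerivWithinAt h e (Ici W) W := by
    apply hg.hasDerivWithinAt.congr
    · intro x hx
      simp only [hh]; rw [if_neg (not_lt.mpr hx)]
    · exact hhW
  have := h1.union h2
  rwa [Iic_union_Ici, hasDerivWithinAt_univ] at this

lemma isOpen_dom_a (a : EReal) : IsOpen {t : ℝ | a < (t : EReal)} :=
  isOpen_lt continuous_const continuous_coe_real_ereal

lemma local_exist (a : EReal) (φ φ' : ℝ → ℝ)
    (hφsm : ContDiffOn ℝ (⊤ : ℕ∞) φ {t : ℝ | a < (t : EReal)})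
    (hφd : ∀ t : ℝ, a < (t : EReal) → HasDerivAt φ (φ' t) t)
    (W L P : ℝ) (hW : 0 < W) (hL : a < (L : EReal)) :
    ∃ ε > 0, ∃ v p : ℝ → ℝ, v W = L ∧ p W = P ∧ ∀ t ∈ Ico W (W + ε),
      a < (v t : EReal) ∧ HasDerivAt v (p t) t ∧
      HasDerivAt p ((1 + p t ^ 2) * (φ' (v t) - p t / t)) t := by
  have hφ1 : ContDiffAt ℝ 1 φ' L := by
    have h1 : ContDiffOn ℝ 1 (deriv φ) {t : ℝ | a < (t : EReal)} := by
      apply hφsm.deriv_of_isOpen (isOpen_dom_a a)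
      norm_cast
    have h2 : ContDiffAt ℝ 1 (deriv φ) L := h1.contDiffAt ((isOpen_dom_a a).mem_nhds hL)
    apply h2.congr_of_eventuallyEq
    filter_upwards [(isOpen_dom_a a).mem_nhds hL] with t ht
    exact (hφd t ht).deriv.symm
  let F : ℝ × ℝ × ℝ → ℝ × ℝ × ℝ := fun x =>
    (1, x.2.2, (1 + x.2.2 ^ 2) * (φ' x.2.1 - x.2.2 / x.1))
  have hF : ContDiffAt ℝ 1 F (W, L, P) := by
    have e1 : ContDiffAt ℝ 1 (fun x : ℝ × ℝ × ℝ => φ' x.2.1) (W, L, P) :=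
      ContDiffAt.comp (g := φ') (W, L, P) hφ1 (by fun_prop)
    have e2 : ContDiffAt ℝ 1 (fun x : ℝ × ℝ × ℝ => x.2.2 / x.1) (W, L, P) :=
      ContDiffAt.div (by fun_prop) (by fun_prop) hW.ne'
    have e3 : ContDiffAt ℝ 1 (fun x : ℝ × ℝ × ℝ => 1 + x.2.2 ^ 2) (W, L, P) := by fun_prop
    exact contDiffAt_const.prodMk (ContDiffAt.prodMk (by fun_prop) (e3.mul (e1.sub e2)))
  obtain ⟨α, hα0, ε, hε, hα⟩ :=
    hF.exists_forall_mem_closedBall_exists_eq_forall_mem_Ioo_hasDerivAt₀ W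
  have d1 : ∀ t ∈ Ioo (W - ε) (W + ε), HasDerivAt (fun t => (α t).1) 1 t := fun t ht =>
    ((ContinuousLinearMap.fst ℝ ℝ (ℝ × ℝ)).hasFDerivAt.comp_hasDerivAt t (hα t ht))
  have d2 : ∀ t ∈ Ioo (W - ε) (W + ε), HasDerivAt (fun t => (α t).2) (F (α t)).2 t := fun t ht =>
    ((ContinuousLinearMap.snd ℝ ℝ (ℝ × ℝ)).hasFDerivAt.comp_hasDerivAt t (hα t ht))
  have d3 : ∀ t ∈ Ioo (W - ε) (W + ε), HasDerivAt (fun t => (α t).2.1) (F (α t)).2.1 t :=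
    fun t ht => ((ContinuousLinearMap.fst ℝ ℝ ℝ).hasFDerivAt.comp_hasDerivAt t (d2 t ht))
  have d4 : ∀ t ∈ Ioo (W - ε) (W + ε), HasDerivAt (fun t => (α t).2.2) (F (α t)).2.2 t :=
    fun t ht => ((ContinuousLinearMap.snd ℝ ℝ ℝ).hasFDerivAt.comp_hasDerivAt t (d2 t ht))
  have hr : ∀ t ∈ Ico W (W + ε), (α t).1 = t := by
    intro t ht
    have hs : ∀ s ∈ Icc W t, s ∈ Ioo (W - ε) (W + ε) := fun s hs =>
      ⟨by linarith [hs.1], by linarith [hs.2, ht.2]⟩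
    have := constant_of_has_deriv_right_zero (f := fun s => (α s).1 - s) (a := W) (b := t)
      (fun s h => ((d1 s (hs s h)).sub (hasDerivAt_id s)).continuousAt.continuousWithinAt)
      (fun s h => by
        have := ((d1 s (hs s ⟨h.1, h.2.le⟩)).sub (hasDerivAt_id s))
        rw [sub_self] at this
        exact this.hasDerivWithinAt) t ⟨ht.1, le_rfl⟩
    simp only [hα0] at this
    linarith
  have hW' : W ∈ Ioo (W - ε) (W + ε) := ⟨by linarith, by linarith⟩
  have hev : ∀ᶠ t in 𝓝 W, a < ((α t).2.1 : EReal) := by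
    have := (d3 W hW').continuousAt
    refine this.eventually_mem (s := {t : ℝ | a < (t : EReal)}) ?_
    apply (isOpen_dom_a a).mem_nhds
    simpa [hα0] using hL
  obtain ⟨δ, hδ, hb⟩ := Metric.eventually_nhds_iff.mp hev
  refine ⟨min ε δ, lt_min hε hδ, fun t => (α t).2.1, fun t => (α t).2.2, by simp [hα0],
    by simp [hα0], ?_⟩
  intro t ht
  have h1 : t < W + ε := lt_of_lt_of_le ht.2 (by linarith [min_le_left ε δ])
  have h2 : t < W + δ := lt_of_lt_of_le ht.2 (by linarith [min_le_right ε δ])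
  have ht' : t ∈ Ioo (W - ε) (W + ε) := ⟨by linarith [ht.1], h1⟩
  refine ⟨hb ?_, d3 t ht', ?_⟩
  · rw [Real.dist_eq, abs_lt]; constructor <;> linarith [ht.1]
  · have := d4 t ht'
    simp only [F] at this
    rwa [hr t ⟨ht.1, h1⟩] at this

lemma Dom_ofReal (W : ℝ) : Dom (ENNReal.ofReal W) = Ico 0 W := by
  ext r
  simp only [Dom, mem_ofPred_eq, mem_Ico]
  constructor
  · rintro ⟨h, h2⟩
    exact ⟨h, (ENNReal.ofReal_lt_ofReal_iff_of_nonneg h).mp h2⟩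
  · rintro ⟨h, h2⟩
    exact ⟨h, (ENNReal.ofReal_lt_ofReal_iff_of_nonneg h).mpr h2⟩

lemma Dom_top : Dom ⊤ = Ici 0 := by
  ext r
  simp [Dom]

lemma Dom_convex (ω : ℝ≥0∞) : Convex ℝ (Dom ω) := by
  by_cases h : ω = ⊤
  · rw [h, Dom_top]; exact convex_Ici 0
  · rw [← ENNReal.ofReal_toReal h, Dom_ofReal]; exact convex_Ico _ _

lemma Dom_mem_nhds (ω : ℝ≥0∞) (r : ℝ) (hr : r ∈ Dom ω) (h0 : 0 < r) : Dom ω ∈ 𝓝 r := by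
  by_cases h : ω = ⊤
  · rw [h, Dom_top]; exact Ici_mem_nhds h0
  · rw [← ENNReal.ofReal_toReal h, Dom_ofReal] at hr ⊢; exact Ico_mem_nhds h0 hr.2

lemma Dom_nhds_zero (ω : ℝ≥0∞) (hω : 0 < ω) : Dom ω ∈ 𝓝[>] (0:ℝ) := by
  by_cases h : ω = ⊤
  · rw [h, Dom_top]
    filter_upwards [self_mem_nhdsWithin] with t ht using le_of_lt (mem_Ioi.mp ht)
  · have : 0 < ω.toReal := ENNReal.toReal_pos hω.ne' h
    rw [← ENNReal.ofReal_toReal h, Dom_ofReal]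
    filter_upwards [Ioo_mem_nhdsGT this] with t ht using ⟨ht.1.le, ht.2⟩

lemma Dom_zero (ω : ℝ≥0∞) (hω : 0 < ω) : (0:ℝ) ∈ Dom ω := by
  simp [Dom, hω]

/-- Extension of a bounded solution past a finite endpoint. -/
lemma extend_sol (a : EReal) (φ φ' φ'' : ℝ → ℝ)
    (hφsm : ContDiffOn ℝ (⊤ : ℕ∞) φ {t : ℝ | a < (t : EReal)})
    (hφd : ∀ t : ℝ, a < (t : EReal) → HasDerivAt φ (φ' t) t)
    (hφd2 : ∀ t : ℝ, a < (t : EReal) → HasDerivAt φ' (φ'' t) t)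
    (W L P : ℝ) (hW : 0 < W) (hL : a < (L : EReal))
    (u u' u'' : ℝ → ℝ)
    (hmem : ∀ r ∈ Ico 0 W, a < (u r : EReal))
    (hd : ∀ r ∈ Ico 0 W, HasDerivWithinAt u (u' r) (Ico 0 W) r)
    (hd2 : ∀ r ∈ Ico 0 W, HasDerivWithinAt u' (u'' r) (Ico 0 W) r)
    (hc : ContinuousOn u'' (Ico 0 W))
    (heq : ∀ r ∈ Ico 0 W, 0 < r → u'' r = (1 + u' r ^ 2) * (φ' (u r) - u' r / r))
    (hu : Tendsto u (𝓝[<] W) (𝓝 L)) (hu' : Tendsto u' (𝓝[<] W) (𝓝 P)) :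
    ∃ W' > W, ∃ v v' v'' : ℝ → ℝ,
        (∀ r ∈ Ico 0 W', a < (v r : EReal)) ∧
        v 0 = u 0 ∧ v' 0 = u' 0 ∧
        (∀ r ∈ Ico 0 W', HasDerivWithinAt v (v' r) (Ico 0 W') r) ∧
        (∀ r ∈ Ico 0 W', HasDerivWithinAt v' (v'' r) (Ico 0 W') r) ∧
        ContinuousOn v'' (Ico 0 W') ∧
        (∀ r ∈ Ico 0 W', 0 < r → v'' r = (1 + v' r ^ 2) * (φ' (v r) - v' r / r)) := by
  obtain ⟨ε, hε, g, p, hg, hp, H⟩ := local_exist a φ φ' hφsm hφd W L P hW hL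
  set v : ℝ → ℝ := fun t => if t < W then u t else g t with hv
  set v' : ℝ → ℝ := fun t => if t < W then u' t else p t with hv'
  set v'' : ℝ → ℝ := fun t => if t ≤ 0 then u'' t else
    (1 + v' t ^ 2) * (φ' (v t) - v' t / t) with hv''
  have vl : ∀ t < W, v t = u t := fun t ht => by simp only [hv]; rw [if_pos ht]
  have vl' : ∀ t < W, v' t = u' t := fun t ht => by simp only [hv']; rw [if_pos ht]
  have vr : ∀ t, W ≤ t → v t = g t := fun t ht => by simp only [hv]; rw [if_neg ht.not_gt]
  have vr' : ∀ t, W ≤ t → v' t = p t := fun t ht => by simp only [hv']; rw [if_neg ht.not_gt]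
  have vpos : ∀ t, 0 < t → v'' t = (1 + v' t ^ 2) * (φ' (v t) - v' t / t) := fun t ht => by
    simp only [hv'']; rw [if_neg ht.not_ge]
  have vl'' : ∀ t ∈ Ico 0 W, v'' t = u'' t := fun t ht => by
    by_cases h : t ≤ 0
    · simp only [hv'']; rw [if_pos h]
    · push Not at h
      rw [vpos t h, heq t ht h, vl t ht.2, vl' t ht.2]
  have hA : ∀ r ∈ Ico 0 (W + ε), a < (v r : EReal) := by
    intro r hr
    by_cases h : r < W
    · rw [vl r h]; exact hmem r ⟨hr.1, h⟩
    · push Not at h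
      rw [vr r h]; exact (H r ⟨h, hr.2⟩).1
  have hIco : ∀ r, 0 < r → r < W → Ico 0 W ∈ 𝓝 r := fun r h h' => Ico_mem_nhds h h'
  have hWm : W ∈ Ico W (W + ε) := ⟨le_rfl, by linarith⟩
  have hWI : Ioo 0 W ∈ 𝓝[<] W := Ioo_mem_nhdsLT hW
  have hu2 : Tendsto u'' (𝓝[<] W) (𝓝 ((1 + p W ^ 2) * (φ' (g W) - p W / W))) := by
    have hφc : ContinuousAt φ' L := (hφd2 L hL).continuousAt
    have t1 : Tendsto (fun r => φ' (u r)) (𝓝[<] W) (𝓝 (φ' L)) := hφc.tendsto.comp hu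
    have t2 : Tendsto (fun r : ℝ => r) (𝓝[<] W) (𝓝 W) := tendsto_id.mono_left nhdsWithin_le_nhds
    have t3 := ((hu'.pow 2).const_add 1).mul (t1.sub (hu'.div t2 hW.ne'))
    rw [hg, hp]
    apply t3.congr'
    filter_upwards [hWI] with r hr
    exact (heq r ⟨hr.1.le, hr.2⟩ hr.1).symm
  have hD1 : ∀ r ∈ Ioo 0 (W + ε), HasDerivAt v (v' r) r := by
    intro r hr
    rcases lt_trichotomy r W with h | h | h
    · rw [vl' r h]
      apply ((hd r ⟨hr.1.le, h⟩).hasDerivAt (hIco r hr.1 h)).congr_of_eventuallyEq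
      filter_upwards [Iio_mem_nhds h] with s hs using vl s hs
    · subst h
      rw [vr' r le_rfl]
      apply glue_deriv u u' g r (p r) hW
      · intro t ht
        exact (hd t ⟨ht.1.le, ht.2⟩).hasDerivAt (hIco t ht.1 ht.2)
      · rwa [hg]
      · rwa [hp]
      · exact (H r hWm).2.1
    · rw [vr' r h.le]
      apply ((H r ⟨h.le, hr.2⟩).2.1).congr_of_eventuallyEq
      filter_upwards [Ioi_mem_nhds h] with s hs using vr s (le_of_lt hs)
  have hD2 : ∀ r ∈ Ioo 0 (W + ε), HasDerivAt v' (v'' r) r := by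
    intro r hr
    rcases lt_trichotomy r W with h | h | h
    · rw [vl'' r ⟨hr.1.le, h⟩]
      apply ((hd2 r ⟨hr.1.le, h⟩).hasDerivAt (hIco r hr.1 h)).congr_of_eventuallyEq
      filter_upwards [Iio_mem_nhds h] with s hs using vl' s hs
    · subst h
      rw [vpos r hW, vr' r le_rfl, vr r le_rfl]
      apply glue_deriv u' u'' p r _ hW
      · intro t ht
        exact (hd2 t ⟨ht.1.le, ht.2⟩).hasDerivAt (hIco t ht.1 ht.2)
      · rwa [hp]
      · exact hu2
      · exact (H r hWm).2.2
    · rw [vpos r hr.1, vr' r h.le, vr r h.le]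
      apply ((H r ⟨h.le, hr.2⟩).2.2).congr_of_eventuallyEq
      filter_upwards [Ioi_mem_nhds h] with s hs using vr' s (le_of_lt hs)
  have h00 : (0:ℝ) ∈ Ico 0 W := ⟨le_rfl, hW⟩
  have hnh : Ico 0 W ∈ 𝓝[Ico 0 (W + ε)] (0:ℝ) := by
    have : Iio W ∈ 𝓝[Ico 0 (W + ε)] (0:ℝ) := mem_nhdsWithin_of_mem_nhds (Iio_mem_nhds hW)
    filter_upwards [this, self_mem_nhdsWithin] with s hs hs' using ⟨hs'.1, hs⟩
  refine ⟨W + ε, by linarith, v, v', v'', hA, vl 0 hW, vl' 0 hW, ?_, ?_, ?_, ?_⟩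
  · intro r hr
    rcases hr.1.eq_or_lt with h | h
    · subst h
      have h1 : HasDerivWithinAt v (v' 0) (Ico 0 W) 0 := by
        rw [vl' 0 hW]
        exact (hd 0 h00).congr (fun x hx => vl x hx.2) (vl 0 hW)
      exact h1.mono_of_mem_nhdsWithin hnh
    · exact (hD1 r ⟨h, hr.2⟩).hasDerivWithinAt
  · intro r hr
    rcases hr.1.eq_or_lt with h | h
    · subst h
      have h1 : HasDerivWithinAt v' (v'' 0) (Ico 0 W) 0 := by
        rw [vl'' 0 h00]
        exact (hd2 0 h00).congr (fun x hx => vl' x hx.2) (vl' 0 hW)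
      exact h1.mono_of_mem_nhdsWithin hnh
    · exact (hD2 r ⟨h, hr.2⟩).hasDerivWithinAt
  · intro r hr
    rcases hr.1.eq_or_lt with h | h
    · subst h
      have h1 : ContinuousWithinAt v'' (Ico 0 W) 0 :=
        (hc 0 h00).congr (fun x hx => vl'' x hx) (vl'' 0 h00)
      exact h1.mono_of_mem_nhdsWithin hnh
    · apply ContinuousAt.continuousWithinAt
      have c1 := (hD1 r ⟨h, hr.2⟩).continuousAt
      have c2 := (hD2 r ⟨h, hr.2⟩).continuousAt
      have c3 : ContinuousAt (fun t => φ' (v t)) r :=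
        ContinuousAt.comp (g := φ') (hφd2 _ (hA r hr)).continuousAt c1
      have c4 : ContinuousAt (fun t => (1 + v' t ^ 2) * (φ' (v t) - v' t / t)) r :=
        (continuousAt_const.add (c2.pow 2)).mul (c3.sub (c2.div continuousAt_id h.ne'))
      apply c4.congr
      filter_upwards [Ioi_mem_nhds h] with s hs using (vpos s hs).symm
  · intro r hr h
    exact vpos r h

/-- (Bowl-type examples.) For `φ` smooth on `(a,∞)` with `φ' > 0`,
`φ'' ≥ 0`, the maximal solution `u` on `[0, ω₊)` of
`u'' = (1 + u'²)(φ'(u) - u'/r)` with `u(0) = u₀`, `u'(0) = 0` satisfies `u'' > 0`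
everywhere (with `u''(0) = φ'(u₀)/2`), `0 < u' < r·φ'(u)` on `(0, ω₊)`, and
`u(r) → +∞` as `r → ω₊`; in particular `u` is strictly convex with minimum at `0`. -/
theorem stmt_11 (a : EReal) (φ φ' φ'' : ℝ → ℝ)
    (hφsm : ContDiffOn ℝ (⊤ : ℕ∞) φ {t : ℝ | a < (t : EReal)})
    (hφd : ∀ t : ℝ, a < (t : EReal) → HasDerivAt φ (φ' t) t)
    (hφd2 : ∀ t : ℝ, a < (t : EReal) → HasDerivAt φ' (φ'' t) t)
    (hφ'pos : ∀ t : ℝ, a < (t : EReal) → 0 < φ' t)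
    (hφ''nn : ∀ t : ℝ, a < (t : EReal) → 0 ≤ φ'' t)
    (u₀ : ℝ) (hu₀ : a < (u₀ : EReal))
    (ω : ℝ≥0∞) (hω : 0 < ω)
    (u u' u'' : ℝ → ℝ)
    (hmem : ∀ r ∈ Dom ω, a < (u r : EReal))
    (h0 : u 0 = u₀) (h0' : u' 0 = 0)
    (hd : ∀ r ∈ Dom ω, HasDerivWithinAt u (u' r) (Dom ω) r)
    (hd2 : ∀ r ∈ Dom ω, HasDerivWithinAt u' (u'' r) (Dom ω) r)
    (hc : ContinuousOn u'' (Dom ω))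
    (heq : ∀ r ∈ Dom ω, 0 < r → u'' r = (1 + u' r ^ 2) * (φ' (u r) - u' r / r))
    -- maximality: there is no solution with the same initial data on a larger interval
    (hmax : ∀ ω' : ℝ≥0∞, ω < ω' →
      ¬ ∃ v v' v'' : ℝ → ℝ,
        (∀ r ∈ Dom ω', a < (v r : EReal)) ∧
        v 0 = u₀ ∧ v' 0 = 0 ∧
        (∀ r ∈ Dom ω', HasDerivWithinAt v (v' r) (Dom ω') r) ∧
        (∀ r ∈ Dom ω', HasDerivWithinAt v' (v'' r) (Dom ω') r) ∧
        ContinuousOn v'' (Dom ω') ∧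
        (∀ r ∈ Dom ω', 0 < r → v'' r = (1 + v' r ^ 2) * (φ' (v r) - v' r / r))) :
    (∀ r ∈ Dom ω, 0 < u'' r) ∧
    u'' 0 = φ' u₀ / 2 ∧
    (∀ r ∈ Dom ω, 0 < r → 0 < u' r ∧ u' r < r * φ' (u r)) ∧
    Tendsto u (rightEnd ω) atTop ∧
    StrictConvexOn ℝ (Dom ω) u ∧
    (∀ r ∈ Dom ω, u 0 ≤ u r) := by
  have hz : (0:ℝ) ∈ Dom ω := Dom_zero ω hω
  have hconv := Dom_convex ω
  have hnn : ∀ r ∈ Dom ω, 0 ≤ r := fun r hr => hr.1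
  have hsub : ∀ r ∈ Dom ω, Icc 0 r ⊆ Dom ω := fun r hr => hconv.ordConnected.out hz hr
  have hnh := Dom_mem_nhds ω
  have hint : ∀ r ∈ interior (Dom ω), r ∈ Dom ω ∧ 0 < r := by
    intro r hr
    refine ⟨interior_subset hr, ?_⟩
    have : r ∈ interior (Ici (0:ℝ)) := interior_mono (fun x hx => hx.1) hr
    rwa [interior_Ici] at this
  have hcu : ContinuousOn u (Dom ω) := fun r hr => (hd r hr).continuousWithinAt
  have hcu' : ContinuousOn u' (Dom ω) := fun r hr => (hd2 r hr).continuousWithinAt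
  have hval : u'' 0 = φ' u₀ / 2 := by
    have hle : 𝓝[>] (0:ℝ) ≤ 𝓝[Dom ω] 0 := by
      rw [nhdsWithin, nhdsWithin]
      refine le_inf inf_le_left ?_
      have := Dom_nhds_zero ω hω
      exact le_principal_iff.mpr this
    have hle2 : 𝓝[>] (0:ℝ) ≤ 𝓝[Dom ω \ {0}] 0 := by
      rw [nhdsWithin, nhdsWithin]
      refine le_inf inf_le_left ?_
      rw [le_principal_iff]
      filter_upwards [Dom_nhds_zero ω hω, self_mem_nhdsWithin] with t ht ht'
      exact ⟨ht, ne_of_gt ht'⟩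
    have t1 : Tendsto (fun r => u' r / r) (𝓝[>] 0) (𝓝 (u'' 0)) := by
      have := (hasDerivWithinAt_iff_tendsto_slope.mp (hd2 0 hz)).mono_left hle2
      apply this.congr
      intro r
      simp [slope_def_field, h0']
    have t2 : Tendsto u' (𝓝[>] 0) (𝓝 0) := by
      have := (hcu' 0 hz).tendsto.mono_left hle
      rwa [h0'] at this
    have t3 : Tendsto u (𝓝[>] 0) (𝓝 u₀) := by
      have := (hcu 0 hz).tendsto.mono_left hle
      rwa [h0] at this
    have t4 : Tendsto u'' (𝓝[>] 0) (𝓝 (u'' 0)) := (hc 0 hz).tendsto.mono_left hle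
    have t5 : Tendsto (fun r => φ' (u r)) (𝓝[>] 0) (𝓝 (φ' u₀)) :=
      (hφd2 u₀ hu₀).continuousAt.tendsto.comp t3
    have t6 := ((t2.pow 2).const_add 1).mul (t5.sub t1)
    have t7 : Tendsto u'' (𝓝[>] 0) (𝓝 ((1 + 0 ^ 2) * (φ' u₀ - u'' 0))) := by
      apply t6.congr'
      filter_upwards [Dom_nhds_zero ω hω, self_mem_nhdsWithin] with t ht ht'
      exact (heq t ht ht').symm
    have := tendsto_nhds_unique t4 t7
    linarith
  have hu'pos_of : ∀ r ∈ Dom ω, 0 < r → (∀ s ∈ Ico 0 r, 0 < u'' s) → 0 < u' r := by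
    intro r hr hr0 H
    have hm : StrictMonoOn u' (Icc 0 r) := by
      apply strictMonoOn_of_hasDerivWithinAt_pos (convex_Icc 0 r) (f' := u'')
        (hcu'.mono (hsub r hr))
      · intro x hx
        exact (hd2 x (hsub r hr (interior_subset hx))).mono (interior_subset.trans (hsub r hr))
      · intro x hx
        rw [interior_Icc] at hx
        exact H x ⟨hx.1.le, hx.2⟩
    have := hm ⟨le_rfl, hr0.le⟩ ⟨hr0.le, le_rfl⟩ hr0
    rwa [h0'] at this
  have hpos : ∀ r ∈ Dom ω, 0 < u'' r := by
    by_contra hcon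
    push Not at hcon
    obtain ⟨r₁, hr₁, hle⟩ := hcon
    set S : Set ℝ := Icc 0 r₁ ∩ u'' ⁻¹' Iic 0 with hS
    have hSc : IsClosed S := (hc.mono (hsub r₁ hr₁)).preimage_isClosed_of_isClosed
      isClosed_Icc isClosed_Iic
    have hSne : S.Nonempty := ⟨r₁, ⟨hr₁.1, le_rfl⟩, hle⟩
    have hSb : BddBelow S := ⟨0, fun x hx => hx.1.1⟩
    set r₀ := sInf S with hr₀
    have hr₀S : r₀ ∈ S := hSc.csInf_mem hSne hSb
    have hr₀D : r₀ ∈ Dom ω := hsub r₁ hr₁ hr₀S.1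
    have hr₀le : u'' r₀ ≤ 0 := hr₀S.2
    have hbef : ∀ s ∈ Ico 0 r₀, 0 < u'' s := by
      intro s hs
      by_contra hns
      push Not at hns
      have : s ∈ S := ⟨⟨hs.1, hs.2.le.trans hr₀S.1.2⟩, hns⟩
      exact absurd (csInf_le hSb this) (not_le.mpr hs.2)
    have hr₀pos : 0 < r₀ := by
      rcases hr₀S.1.1.eq_or_lt with h | h
      · rw [← h, hval] at hr₀le
        linarith [hφ'pos u₀ hu₀]
      · exact h
    have hup := hu'pos_of r₀ hr₀D hr₀pos hbef
    have hn := hnh r₀ hr₀D hr₀pos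
    have hua := hmem r₀ hr₀D
    have D1 := (hd r₀ hr₀D).hasDerivAt hn
    have D2 := (hd2 r₀ hr₀D).hasDerivAt hn
    have Dg : HasDerivAt (fun r => φ' (u r) - u' r / r)
        (φ'' (u r₀) * u' r₀ - (u'' r₀ * r₀ - u' r₀ * 1) / r₀ ^ 2) r₀ :=
      ((hφd2 _ hua).comp r₀ D1).sub (D2.div (hasDerivAt_id r₀) hr₀pos.ne')
    have hgpos : ∀ s ∈ Ioo 0 r₀, 0 < φ' (u s) - u' s / s := by
      intro s hs
      have h1 := hbef s ⟨hs.1.le, hs.2⟩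
      rw [heq s (hsub r₀ hr₀D ⟨hs.1.le, hs.2.le⟩) hs.1] at h1
      exact (mul_pos_iff_of_pos_left (by positivity)).mp h1
    have hg0 : φ' (u r₀) - u' r₀ / r₀ ≤ 0 := by
      rw [heq r₀ hr₀D hr₀pos] at hr₀le
      by_contra hh
      push Not at hh
      have : 0 < (1 + u' r₀ ^ 2) * (φ' (u r₀) - u' r₀ / r₀) := mul_pos (by positivity) hh
      linarith
    have hslope : φ'' (u r₀) * u' r₀ - (u'' r₀ * r₀ - u' r₀ * 1) / r₀ ^ 2 ≤ 0 := by
      have hT := (hasDerivAt_iff_tendsto_slope_left_right.mp Dg).1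
      apply le_of_tendsto hT
      filter_upwards [Ioo_mem_nhdsLT hr₀pos] with s hs
      rw [slope_def_field]
      apply div_nonpos_of_nonneg_of_nonpos
      · linarith [hgpos s hs]
      · linarith [hs.2]
    have h1 : 0 ≤ φ'' (u r₀) * u' r₀ := mul_nonneg (hφ''nn _ hua) hup.le
    have h2 : (u'' r₀ * r₀ - u' r₀ * 1) / r₀ ^ 2 < 0 := by
      apply div_neg_of_neg_of_pos _ (by positivity)
      nlinarith
    linarith
  have hu'pos : ∀ r ∈ Dom ω, 0 < r → 0 < u' r := fun r hr h =>
    hu'pos_of r hr h (fun s hs => hpos s (hsub r hr ⟨hs.1, hs.2.le⟩))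
  have hu'lt : ∀ r ∈ Dom ω, 0 < r → u' r < r * φ' (u r) := by
    intro r hr h
    have h1 := hpos r hr
    rw [heq r hr h] at h1
    have h2 : 0 < φ' (u r) - u' r / r := (mul_pos_iff_of_pos_left (by positivity)).mp h1
    have h3 : u' r / r < φ' (u r) := by linarith
    rw [div_lt_iff₀ h] at h3
    linarith
  have hm' : StrictMonoOn u' (Dom ω) :=
    strictMonoOn_of_hasDerivWithinAt_pos hconv (f' := u'') hcu'
      (fun x hx => (hd2 x (interior_subset hx)).mono interior_subset)
      (fun x hx => hpos x (interior_subset hx))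
  have hm : StrictMonoOn u (Dom ω) :=
    strictMonoOn_of_hasDerivWithinAt_pos hconv (f' := u') hcu
      (fun x hx => (hd x (interior_subset hx)).mono interior_subset)
      (fun x hx => hu'pos x (hint x hx).1 (hint x hx).2)
  have hsc : StrictConvexOn ℝ (Dom ω) u := by
    apply StrictMonoOn.strictConvexOn_of_deriv hconv hcu
    have hde : ∀ x ∈ interior (Dom ω), deriv u x = u' x := fun x hx =>
      ((hd x (hint x hx).1).hasDerivAt (hnh x (hint x hx).1 (hint x hx).2)).deriv
    intro x hx y hy hxy
    rw [hde x hx, hde y hy]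
    exact hm' (hint x hx).1 (hint y hy).1 hxy
  have hmin : ∀ r ∈ Dom ω, u 0 ≤ u r := fun r hr => hm.monotoneOn hz hr hr.1
  refine ⟨hpos, hval, fun r hr h => ⟨hu'pos r hr h, hu'lt r hr h⟩, ?_, hsc, hmin⟩
  by_cases htop : ω = ⊤
  · rw [rightEnd, if_pos htop]
    have hD : Dom ω = Ici 0 := by rw [htop, Dom_top]
    have h1D : (1:ℝ) ∈ Dom ω := by rw [hD]; exact mem_Ici.mpr zero_le_one
    have hc1 : 0 < u' 1 := hu'pos 1 h1D one_pos
    have hlow : ∀ r, 1 ≤ r → u 1 + u' 1 * (r - 1) ≤ u r := by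
      intro r hr
      have hI : Icc 1 r ⊆ Dom ω := fun x hx => by
        rw [hD]; exact zero_le_one.trans hx.1
      have hmo : MonotoneOn (fun x => u x - u' 1 * x) (Icc 1 r) := by
        apply monotoneOn_of_hasDerivWithinAt_nonneg (convex_Icc 1 r) (f' := fun x => u' x - u' 1)
        · exact (hcu.mono hI).sub (by fun_prop)
        · intro x hx
          have hx' := interior_subset hx
          have e1 := (hd x (hI hx')).mono (interior_subset.trans hI)
          have e2 : HasDerivAt (fun x : ℝ => u' 1 * x) (u' 1) x := by
            simpa using (hasDerivAt_id x).const_mul (u' 1)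
          exact e1.sub e2.hasDerivWithinAt
        · intro x hx
          have hx' := interior_subset hx
          have := hm'.monotoneOn h1D (hI hx') hx'.1
          linarith
      have := hmo ⟨le_rfl, hr⟩ ⟨hr, le_rfl⟩ hr
      simp only at this
      linarith
    have ht : Tendsto (fun r : ℝ => u 1 + u' 1 * (r - 1)) atTop atTop := by
      apply tendsto_atTop_add_const_left
      apply Tendsto.const_mul_atTop hc1
      exact tendsto_atTop_add_const_right _ (-1) tendsto_id
    apply tendsto_atTop_mono' _ _ ht
    filter_upwards [eventually_ge_atTop 1] with r hr using hlow r hr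
  · rw [rightEnd, if_neg htop]
    obtain ⟨W, hWdef⟩ : ∃ W, W = ω.toReal := ⟨_, rfl⟩
    have hW : 0 < W := hWdef ▸ ENNReal.toReal_pos hω.ne' htop
    have hωW : ω = ENNReal.ofReal W := by rw [hWdef, ENNReal.ofReal_toReal htop]
    have hD : Dom ω = Ico 0 W := by rw [hωW, Dom_ofReal]
    rw [← hWdef]
    have hIoo : Ioo 0 W ⊆ Dom ω := by rw [hD]; exact Ioo_subset_Ico_self
    by_cases hb : BddAbove (u '' Ioo 0 W)
    · exfalso
      have hne : (Ioo 0 W).Nonempty := nonempty_Ioo.mpr hW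
      have hlim := (hm.monotoneOn.mono hIoo).tendsto_nhdsWithin_Ioo_left hne hb
      set L := sSup (u '' Ioo 0 W) with hLdef
      have huL : ∀ r ∈ Ioo 0 W, u r ≤ L := fun r hr => le_csSup hb (mem_image_of_mem u hr)
      have haL : ∀ t : ℝ, u₀ ≤ t → a < (t : EReal) := fun t ht =>
        hu₀.trans_le (EReal.coe_le_coe_iff.mpr ht)
      have hL0 : u₀ ≤ L := by
        have hh : W / 2 ∈ Ioo 0 W := ⟨by linarith, by linarith⟩
        rw [← h0]
        exact (hmin _ (hIoo hh)).trans (huL _ hh)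
      have hφm : MonotoneOn φ' (Ici u₀) := by
        apply monotoneOn_of_hasDerivWithinAt_nonneg (convex_Ici u₀) (f' := φ'')
        · exact fun t ht => (hφd2 t (haL t ht)).continuousAt.continuousWithinAt
        · exact fun t ht => (hφd2 t (haL t (interior_subset ht))).hasDerivWithinAt
        · exact fun t ht => hφ''nn t (haL t (interior_subset ht))
      have hb' : BddAbove (u' '' Ioo 0 W) := by
        refine ⟨W * φ' L, ?_⟩
        rintro _ ⟨r, hr, rfl⟩
        have e1 := hu'lt r (hIoo hr) hr.1
        have e0 : u₀ ≤ u r := by rw [← h0]; exact hmin r (hIoo hr)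
        have e2 : φ' (u r) ≤ φ' L := hφm e0 hL0 (huL r hr)
        have e3 := hφ'pos L (haL L hL0)
        have e4 := hφ'pos (u r) (haL _ e0)
        nlinarith [hr.1, hr.2, mul_le_mul hr.2.le e2 e4.le hW.le]
      have hlim' := (hm'.monotoneOn.mono hIoo).tendsto_nhdsWithin_Ioo_left hne hb'
      rw [hD] at hmem hd hd2 hc heq
      obtain ⟨W', hW', v, v', v'', q1, q2, q3, q4, q5, q6, q7⟩ :=
        extend_sol a φ φ' φ'' hφsm hφd hφd2 W L _ hW (haL L hL0) u u' u'' hmem hd hd2 hc heq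
          hlim hlim'
      refine hmax (ENNReal.ofReal W') ?_ ⟨v, v', v'', ?_⟩
      · rw [hωW]; exact (ENNReal.ofReal_lt_ofReal_iff (hW.trans hW')).mpr hW'
      · rw [Dom_ofReal]
        exact ⟨q1, q2.trans h0, q3.trans h0', q4, q5, q6, q7⟩
    · rw [tendsto_atTop]
      intro M
      rw [not_bddAbove_iff] at hb
      obtain ⟨_, ⟨x, hx, rfl⟩, hMx⟩ := hb M
      filter_upwards [Ioo_mem_nhdsLT hx.2] with r hr
      exact hMx.le.trans (hm.monotoneOn (hIoo hx) (hIoo ⟨hx.1.trans hr.1, hr.2⟩) hr.1.le)
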